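/- Let d ≥ 2 and let A be a real d×n matrix of rank d with no zero columns. For a flat F of A let rk(F) denote the rank of the column-submatrix A_F. Then 2·(−1)^d·( d·μ(∅,{1,…,n}) + Σ_{F flat of A with rk(F) = d−1} μ(∅,F) ) ≤ 2·(n−d)·binomial(n−1, d−2), with equality if and only if every d columns of A are linearly independent (the matroid of A is uniform). (The left-hand side equals 2(−1)^d(d·χ(0) + χ′(0)) for the characteristic polynomial χ of the matroid of A, which is the degree of the entropic discriminant of A; thus the generic value 2(n−d)·binomial(n−1,d−2) is an upper bound, attained exactly in the uniform case.) -/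

import Mathlib

open scoped Classical

/-- The `j`-th column of `A`. -/
def matCol {d n : ℕ} (A : Matrix (Fin d) (Fin n) ℝ) (j : Fin n) : Fin d → ℝ :=
  fun i => A i j

/-- `J` is a flat of `A` if `J = {i : Aᵢ ∈ span{Aⱼ : j ∈ J}}`. -/
def IsFlat {d n : ℕ} (A : Matrix (Fin d) (Fin n) ℝ) (J : Finset (Fin n)) : Prop :=
  ∀ i : Fin n, i ∈ J ↔ matCol A i ∈ Submodule.span ℝ (matCol A '' ↑J)

open Finset Submodule

/-- The rank of the columns of `A` indexed by `S`. -/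
noncomputable def colRank {d n : ℕ} (A : Matrix (Fin d) (Fin n) ℝ) (S : Finset (Fin n)) : ℕ :=
  Module.finrank ℝ (span ℝ (matCol A '' ↑S))

/-- The smallest flat of `A` containing `S`. -/
noncomputable def flatClosure {d n : ℕ} (A : Matrix (Fin d) (Fin n) ℝ) (S : Finset (Fin n)) :
    Finset (Fin n) :=
  univ.filter fun i => matCol A i ∈ span ℝ (matCol A '' ↑S)

/-- The flats covered by `F` that avoid `e`. -/
noncomputable def coatomsAvoiding {d n : ℕ} (A : Matrix (Fin d) (Fin n) ℝ) (F : Finset (Fin n))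
    (e : Fin n) : Finset (Finset (Fin n)) :=
  univ.filter fun G => IsFlat A G ∧ G ⊆ F ∧ e ∉ G ∧ colRank A G + 1 = colRank A F

/-- The bases of the flat `F`. -/
noncomputable def flatBases {d n : ℕ} (A : Matrix (Fin d) (Fin n) ℝ) (F : Finset (Fin n)) :
    Finset (Finset (Fin n)) :=
  (powersetCard (colRank A F) F).filter fun S => flatClosure A S = F

section Flats

variable {d n : ℕ} {A : Matrix (Fin d) (Fin n) ℝ} {F G S T : Finset (Fin n)} {e : Fin n}

theorem mem_flatClosure {i : Fin n} :
    i ∈ flatClosure A S ↔ matCol A i ∈ span ℝ (matCol A '' ↑S) := by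
  simp [flatClosure]

theorem subset_flatClosure : S ⊆ flatClosure A S := fun _ hi =>
  mem_flatClosure.2 (subset_span ⟨_, hi, rfl⟩)

theorem span_flatClosure :
    span ℝ (matCol A '' ↑(flatClosure A S)) = span ℝ (matCol A '' ↑S) := by
  apply le_antisymm
  · rw [span_le]
    rintro _ ⟨i, hi, rfl⟩
    exact mem_flatClosure.1 hi
  · exact span_mono (Set.image_mono (by exact_mod_cast subset_flatClosure))

theorem isFlat_flatClosure : IsFlat A (flatClosure A S) := fun i => by
  rw [span_flatClosure, mem_flatClosure]

theorem IsFlat.flatClosure_eq (hF : IsFlat A F) : flatClosure A F = F := by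
  ext i
  rw [mem_flatClosure, ← hF i]

theorem flatClosure_mono (h : S ⊆ T) : flatClosure A S ⊆ flatClosure A T := fun i hi =>
  mem_flatClosure.2 (span_mono (Set.image_mono (by exact_mod_cast h)) (mem_flatClosure.1 hi))

theorem IsFlat.flatClosure_subset (hF : IsFlat A F) (h : S ⊆ F) : flatClosure A S ⊆ F :=
  hF.flatClosure_eq ▸ flatClosure_mono h

theorem colRank_flatClosure : colRank A (flatClosure A S) = colRank A S := by
  rw [colRank, span_flatClosure, colRank]

theorem colRank_le_card : colRank A S ≤ #S := by
  classical
  have := finrank_span_finset_le_card (R := ℝ) (S.image (matCol A))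
  rw [coe_image] at this
  exact this.trans card_image_le

@[simp]
theorem colRank_empty : colRank A ∅ = 0 :=
  Nat.le_zero.1 colRank_le_card

theorem IsFlat.eq_of_subset_of_colRank_le (hF : IsFlat A F) (hG : IsFlat A G) (h : F ⊆ G)
    (hr : colRank A G ≤ colRank A F) : F = G := by
  have hs : span ℝ (matCol A '' ↑F) = span ℝ (matCol A '' ↑G) :=
    Submodule.eq_of_le_of_finrank_le (span_mono (Set.image_mono (by exact_mod_cast h))) hr
  ext i
  rw [hF i, hG i, hs]

theorem IsFlat.colRank_insert (hF : IsFlat A F) (he : e ∉ F) :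
    colRank A (insert e F) = colRank A F + 1 := by
  have he' : matCol A e ∉ span ℝ (matCol A '' ↑F) := fun h => he ((hF e).2 h)
  rw [colRank, coe_insert, Set.image_insert_eq, span_insert, sup_comm]
  exact finrank_sup_span_singleton he'

theorem isFlat_empty (hcol : ∀ j, matCol A j ≠ 0) : IsFlat A ∅ := fun i => by
  simp [hcol i]

theorem isFlat_univ : IsFlat A univ := fun i => by
  simpa using subset_span (Set.mem_range_self i)

theorem flatClosure_insert_flatClosure :
    flatClosure A (insert e (flatClosure A S)) = flatClosure A (insert e S) := by
  apply Subset.antisymm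
  · refine isFlat_flatClosure.flatClosure_subset (insert_subset ?_ ?_)
    · exact subset_flatClosure (mem_insert_self _ _)
    · exact flatClosure_mono (subset_insert _ _)
  · exact flatClosure_mono (insert_subset_insert _ subset_flatClosure)

theorem flatClosure_insert_eq_iff (hF : IsFlat A F) (hG : IsFlat A G) (heF : e ∈ F) :
    flatClosure A (insert e G) = F ↔
      G = F ∨ (G ⊆ F ∧ e ∉ G ∧ colRank A G + 1 = colRank A F) := by
  constructor
  · intro h
    by_cases he : e ∈ G
    · left
      rwa [insert_eq_of_mem he, hG.flatClosure_eq] at h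
    · right
      refine ⟨?_, he, ?_⟩
      · exact (subset_insert _ _).trans (subset_flatClosure.trans h.subset)
      · rw [← h, colRank_flatClosure, hG.colRank_insert he]
  · rintro (rfl | ⟨hsub, he, hr⟩)
    · rw [insert_eq_of_mem heF, hF.flatClosure_eq]
    · refine isFlat_flatClosure.eq_of_subset_of_colRank_le hF
        (hF.flatClosure_subset (insert_subset heF hsub)) ?_
      rw [colRank_flatClosure, hG.colRank_insert he, hr]

end Flats

section Moebius

variable {d n : ℕ} {A : Matrix (Fin d) (Fin n) ℝ} {f : Finset (Fin n) → ℤ}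

/-- Weisner's theorem for the atom spanned by `e`. -/
theorem sum_flatClosure_insert_eq_zero
    (hf : ∀ F, IsFlat A F → F.Nonempty → ∑ G with IsFlat A G ∧ G ⊆ F, f G = 0)
    {e : Fin n} (F : Finset (Fin n)) (hF : IsFlat A F) (he : e ∈ F) :
    ∑ G with IsFlat A G ∧ flatClosure A (insert e G) = F, f G = 0 := by
  induction F using Finset.strongInduction with
  | H F ih =>
    have h := hf F hF ⟨e, he⟩
    have hmaps : ∀ G ∈ univ.filter (fun G => IsFlat A G ∧ G ⊆ F),
        flatClosure A (insert e G) ∈ F.powerset := fun G hG => by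
      simp only [mem_filter, mem_univ, true_and] at hG
      exact mem_powerset.2 (hF.flatClosure_subset (insert_subset he hG.2))
    have hfilter : ∀ K ⊆ F, (univ.filter (fun G => IsFlat A G ∧ G ⊆ F)).filter
        (fun G => flatClosure A (insert e G) = K) =
        univ.filter (fun G => IsFlat A G ∧ flatClosure A (insert e G) = K) := fun K hK => by
      ext G
      simp only [mem_filter, mem_univ, true_and]
      refine ⟨fun h => ⟨h.1.1, h.2⟩, fun h => ⟨⟨h.1, ?_⟩, h.2⟩⟩
      exact (subset_insert e G).trans (subset_flatClosure.trans (h.2.subset.trans hK))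
    rw [← sum_fiberwise_of_maps_to hmaps, sum_eq_single F] at h
    · rwa [hfilter F Subset.rfl] at h
    · intro K hK hne
      rw [mem_powerset] at hK
      rw [hfilter K hK]
      by_cases hKf : IsFlat A K ∧ e ∈ K
      · exact ih K (hK.ssubset_of_ne hne) hKf.1 hKf.2
      · refine sum_eq_zero fun G hG => absurd ?_ hKf
        simp only [mem_filter, mem_univ, true_and] at hG
        rw [← hG.2]
        exact ⟨isFlat_flatClosure, subset_flatClosure (mem_insert_self _ _)⟩
    · simp

theorem neg_one_pow_mul_eq_sum_coatomsAvoiding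
    (hf : ∀ F, IsFlat A F → F.Nonempty → ∑ G with IsFlat A G ∧ G ⊆ F, f G = 0)
    {e : Fin n} {F : Finset (Fin n)} (hF : IsFlat A F) (he : e ∈ F) :
    (-1) ^ colRank A F * f F =
      ∑ G ∈ coatomsAvoiding A F e, (-1) ^ colRank A G * f G := by
  have h := sum_flatClosure_insert_eq_zero hf F hF he
  have hset : univ.filter (fun G => IsFlat A G ∧ flatClosure A (insert e G) = F) =
      insert F (coatomsAvoiding A F e) := by
    ext G
    simp only [mem_filter, mem_univ, true_and, mem_insert, coatomsAvoiding]
    constructor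
    · rintro ⟨hG, h⟩
      exact ((flatClosure_insert_eq_iff hF hG he).1 h).imp_right fun h => ⟨hG, h⟩
    · rintro (rfl | ⟨hG, h⟩)
      · exact ⟨hF, (flatClosure_insert_eq_iff hF hF he).2 (Or.inl rfl)⟩
      · exact ⟨hG, (flatClosure_insert_eq_iff hF hG he).2 (Or.inr h)⟩
  have hnot : F ∉ coatomsAvoiding A F e := by simp [coatomsAvoiding]
  rw [hset, sum_insert hnot] at h
  have hs : ∑ G ∈ coatomsAvoiding A F e, (-1) ^ colRank A G * f G =
      -(-1) ^ colRank A F * ∑ G ∈ coatomsAvoiding A F e, f G := by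
    rw [mul_sum]
    refine sum_congr rfl fun G hG => ?_
    simp only [coatomsAvoiding, mem_filter] at hG
    rw [← hG.2.2.2.2, pow_succ]
    ring
  rw [hs]
  linear_combination (-1) ^ colRank A F * h

theorem neg_one_pow_mul_nonneg (h0 : f ∅ = 1)
    (hf : ∀ F, IsFlat A F → F.Nonempty → ∑ G with IsFlat A G ∧ G ⊆ F, f G = 0)
    (F : Finset (Fin n)) (hF : IsFlat A F) : 0 ≤ (-1) ^ colRank A F * f F := by
  induction F using Finset.strongInduction with
  | H F ih =>
    obtain rfl | ⟨e, he⟩ := F.eq_empty_or_nonempty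
    · simp [h0]
    · rw [neg_one_pow_mul_eq_sum_coatomsAvoiding hf hF he]
      refine sum_nonneg fun G hG => ?_
      simp only [coatomsAvoiding, mem_filter, mem_univ, true_and] at hG
      exact ih G (hG.2.1.ssubset_of_ne (by rintro rfl; exact hG.2.2.1 he)) hG.1

theorem sum_coatomsAvoiding_card_flatBases_le {e : Fin n} {F : Finset (Fin n)}
    (hF : IsFlat A F) (he : e ∈ F) :
    ∑ G ∈ coatomsAvoiding A F e, #(flatBases A G) ≤ #{S ∈ flatBases A F | e ∈ S} := by
  rw [← card_biUnion]
  · refine card_le_card_of_injOn (insert e) ?_ ?_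
    · intro S hS
      simp only [coatomsAvoiding, flatBases, mem_coe, mem_biUnion, mem_filter, mem_univ, true_and,
        mem_powersetCard] at hS
      obtain ⟨G, ⟨hG, hGF, heG, hr⟩, ⟨hSG, hcard⟩, hcl⟩ := hS
      simp only [flatBases, mem_coe, mem_filter, mem_powersetCard]
      refine ⟨⟨⟨insert_subset he (hSG.trans hGF), ?_⟩, ?_⟩, mem_insert_self _ _⟩
      · rw [card_insert_of_notMem fun h => heG (hSG h), hcard, hr]
      · rw [← flatClosure_insert_flatClosure, hcl]
        exact (flatClosure_insert_eq_iff hF hG he).2 (Or.inr ⟨hGF, heG, hr⟩)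
    · have key : ∀ S ∈ (coatomsAvoiding A F e).biUnion (flatBases A), e ∉ S := fun S hS => by
        simp only [coatomsAvoiding, flatBases, mem_biUnion, mem_filter, mem_univ, true_and,
          mem_powersetCard] at hS
        obtain ⟨G, ⟨-, -, heG, -⟩, ⟨hSG, -⟩, -⟩ := hS
        exact fun h => heG (hSG h)
      intro S hS T hT h
      rw [← erase_insert (key S hS), ← erase_insert (key T hT), h]
  · intro G _ K _ hne
    refine disjoint_left.2 fun S hS hS' => hne ?_
    rw [← (mem_filter.1 hS).2, (mem_filter.1 hS').2]

theorem neg_one_pow_mul_le_card_flatBases (h0 : f ∅ = 1)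
    (hf : ∀ F, IsFlat A F → F.Nonempty → ∑ G with IsFlat A G ∧ G ⊆ F, f G = 0)
    (F : Finset (Fin n)) (hF : IsFlat A F) :
    (-1) ^ colRank A F * f F ≤ #(flatBases A F) := by
  induction F using Finset.strongInduction with
  | H F ih =>
    obtain rfl | ⟨e, he⟩ := F.eq_empty_or_nonempty
    · have hmem : ∅ ∈ flatBases A ∅ := by simp [flatBases, hF.flatClosure_eq]
      have hpos : 0 < #(flatBases A ∅) := card_pos.2 ⟨∅, hmem⟩
      rw [colRank_empty, h0, pow_zero, one_mul]
      exact_mod_cast hpos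
    · rw [neg_one_pow_mul_eq_sum_coatomsAvoiding hf hF he]
      have hle : #{S ∈ flatBases A F | e ∈ S} ≤ #(flatBases A F) := card_filter_le _ _
      have h := (sum_coatomsAvoiding_card_flatBases_le hF he).trans hle
      refine le_trans (sum_le_sum fun G hG => ?_)
        ((Nat.cast_sum _ _).symm.trans_le (Nat.cast_le.2 h))
      simp only [coatomsAvoiding, mem_filter, mem_univ, true_and] at hG
      exact ih G (hG.2.1.ssubset_of_ne (by rintro rfl; exact hG.2.2.1 he)) hG.1

theorem neg_one_pow_mul_le_card_flatBases_filter_mem (h0 : f ∅ = 1)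
    (hf : ∀ F, IsFlat A F → F.Nonempty → ∑ G with IsFlat A G ∧ G ⊆ F, f G = 0)
    {e : Fin n} {F : Finset (Fin n)} (hF : IsFlat A F) (he : e ∈ F) :
    (-1) ^ colRank A F * f F ≤ #{S ∈ flatBases A F | e ∈ S} := by
  rw [neg_one_pow_mul_eq_sum_coatomsAvoiding hf hF he]
  have h := sum_coatomsAvoiding_card_flatBases_le hF he
  refine le_trans (sum_le_sum fun G hG => ?_)
        ((Nat.cast_sum _ _).symm.trans_le (Nat.cast_le.2 h))
  exact neg_one_pow_mul_le_card_flatBases h0 hf G (mem_filter.1 hG).2.1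

/-- Summing Weisner's theorem over all elements of the ground set. -/
theorem card_mul_neg_one_pow_mul_univ
    (hf : ∀ F, IsFlat A F → F.Nonempty → ∑ G with IsFlat A G ∧ G ⊆ F, f G = 0) :
    (n : ℤ) * ((-1) ^ colRank A univ * f univ) =
      ∑ G with IsFlat A G ∧ colRank A G + 1 = colRank A univ,
        ((n : ℤ) - #G) * ((-1) ^ colRank A G * f G) := by
  have h : ∑ e : Fin n, (-1) ^ colRank A univ * f univ =
      ∑ e : Fin n, ∑ G ∈ coatomsAvoiding A univ e, (-1) ^ colRank A G * f G :=
    sum_congr rfl fun e _ => neg_one_pow_mul_eq_sum_coatomsAvoiding hf isFlat_univ (mem_univ e)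
  rw [sum_const, card_univ, Fintype.card_fin, nsmul_eq_mul] at h
  rw [h, sum_comm' (t' := univ.filter fun G => IsFlat A G ∧ colRank A G + 1 = colRank A univ)
    (s' := fun G => Gᶜ)]
  · refine sum_congr rfl fun G _ => ?_
    rw [sum_const, card_compl, Fintype.card_fin, nsmul_eq_mul,
      Nat.cast_sub (by simpa using card_le_univ G)]
  · intro e G
    simp only [coatomsAvoiding, mem_filter, mem_univ, true_and, subset_univ, mem_compl]
    tauto

end Moebius

theorem card_powersetCard_filter_mem {n k : ℕ} (hk : 1 ≤ k) (e : Fin n) :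
    #{S ∈ powersetCard k (univ : Finset (Fin n)) | e ∈ S} = (n - 1).choose (k - 1) := by
  have h : #(powersetCard (k - 1) (univ.erase e)) = (n - 1).choose (k - 1) := by
    simp [card_powersetCard, card_erase_of_mem]
  rw [← h]
  refine card_nbij' (fun S => S.erase e) (insert e) ?_ ?_ ?_ ?_
  · intro S hS
    simp only [coe_filter, mem_powersetCard, Set.mem_ofPred_eq] at hS
    simp only [mem_coe, mem_powersetCard]
    exact ⟨erase_subset_erase _ hS.1.1, by rw [card_erase_of_mem hS.2, hS.1.2]⟩
  · intro S hS
    simp only [mem_coe, mem_powersetCard] at hS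
    have he : e ∉ S := fun h => notMem_erase e univ (hS.1 h)
    simp only [coe_filter, mem_powersetCard, Set.mem_ofPred_eq]
    exact ⟨⟨subset_univ _, by rw [card_insert_of_notMem he, hS.2]; omega⟩, mem_insert_self _ _⟩
  · intro S hS
    simp only [coe_filter, Set.mem_ofPred_eq] at hS
    exact insert_erase hS.2
  · intro S hS
    simp only [mem_coe, mem_powersetCard] at hS
    exact erase_insert fun h => notMem_erase e univ (hS.1 h)

section Uniform

variable {d n : ℕ} {A : Matrix (Fin d) (Fin n) ℝ}

theorem colRank_univ : colRank A univ = A.rank := by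
  rw [Matrix.rank_eq_finrank_span_cols, colRank, coe_univ, Set.image_univ]
  rfl

theorem linearIndependent_iff_colRank_eq_card {S : Finset (Fin n)} :
    LinearIndependent ℝ (fun i : ↥S => matCol A i) ↔ colRank A S = #S := by
  rw [linearIndependent_iff_card_eq_finrank_span, Set.finrank, Fintype.card_coe, colRank,
    eq_comm]
  have : Set.range (fun i : ↥S => matCol A i) = matCol A '' ↑S := by
    rw [Set.image_eq_range]
    rfl
  rw [this]

theorem colRank_eq_card_of_uniform (hn : d ≤ n)
    (hA : ∀ I : Finset (Fin n), #I = d → LinearIndependent ℝ (fun i : ↥I => matCol A i))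
    {S : Finset (Fin n)} (hS : #S ≤ d) : colRank A S = #S := by
  obtain ⟨I, hSI, hI⟩ := exists_superset_card_eq hS (by simpa using hn)
  rw [← linearIndependent_iff_colRank_eq_card]
  exact (hA I hI).comp (fun i : ↥S => (⟨i, hSI i.2⟩ : ↥I)) fun i j h =>
    Subtype.ext (congrArg (fun x : ↥I => (x : Fin n)) h)

theorem isFlat_of_uniform (hn : d ≤ n)
    (hA : ∀ I : Finset (Fin n), #I = d → LinearIndependent ℝ (fun i : ↥I => matCol A i))
    {S : Finset (Fin n)} (hS : #S < d) : IsFlat A S := fun i => by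
  refine ⟨fun hi => subset_span ⟨i, hi, rfl⟩, fun hi => by_contra fun hiS => ?_⟩
  have h1 : colRank A (insert i S) = #S + 1 := by
    rw [colRank_eq_card_of_uniform hn hA, card_insert_of_notMem hiS]
    rw [card_insert_of_notMem hiS]
    omega
  have h2 : colRank A (insert i S) = colRank A S := by
    rw [colRank, coe_insert, Set.image_insert_eq, span_insert_eq_span hi, colRank]
  have h3 : colRank A S ≤ #S := colRank_le_card
  omega

theorem eq_neg_one_pow_card_of_uniform {f : Finset (Fin n) → ℤ} (hn : d ≤ n) (h0 : f ∅ = 1)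
    (hf : ∀ F, IsFlat A F → F.Nonempty → ∑ G with IsFlat A G ∧ G ⊆ F, f G = 0)
    (hA : ∀ I : Finset (Fin n), #I = d → LinearIndependent ℝ (fun i : ↥I => matCol A i))
    (F : Finset (Fin n)) (hF : #F < d) : f F = (-1) ^ #F := by
  induction F using Finset.strongInduction with
  | H F ih =>
    obtain rfl | hne := F.eq_empty_or_nonempty
    · simp [h0]
    · have hset : univ.filter (fun G => IsFlat A G ∧ G ⊆ F) = F.powerset := by
        ext G
        simp only [mem_filter, mem_univ, true_and, mem_powerset, and_iff_right_iff_imp]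
        exact fun h => isFlat_of_uniform hn hA ((card_le_card h).trans_lt hF)
      have h := hf F (isFlat_of_uniform hn hA hF) hne
      have h' := sum_powerset_neg_one_pow_card_of_nonempty hne
      rw [hset, ← insert_erase (mem_powerset_self F), sum_insert (notMem_erase _ _)] at h
      rw [← insert_erase (mem_powerset_self F), sum_insert (notMem_erase _ _)] at h'
      have hs : ∑ G ∈ F.powerset.erase F, f G = ∑ G ∈ F.powerset.erase F, (-1) ^ #G := by
        refine sum_congr rfl fun G hG => ?_
        rw [mem_erase, mem_powerset] at hG
        exact ih G (hG.2.ssubset_of_ne hG.1) ((card_le_card hG.2).trans_lt hF)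
      rw [hs] at h
      linarith

/-- In the uniform matroid the hyperplanes are the sets of `d - 1` elements. -/
theorem filter_isFlat_of_uniform (hd : 1 ≤ d) (hn : d ≤ n)
    (hA : ∀ I : Finset (Fin n), #I = d → LinearIndependent ℝ (fun i : ↥I => matCol A i)) :
    univ.filter (fun G => IsFlat A G ∧ colRank A G + 1 = d) = powersetCard (d - 1) univ := by
  ext G
  simp only [mem_filter, mem_univ, true_and, mem_powersetCard, subset_univ]
  constructor
  · rintro ⟨-, hr⟩
    by_cases hG : #G ≤ d
    · rw [colRank_eq_card_of_uniform hn hA hG] at hr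
      omega
    · obtain ⟨I, hIG, hI⟩ := exists_subset_card_eq (le_of_not_ge hG)
      have h1 := colRank_eq_card_of_uniform hn hA hI.le
      have h2 : colRank A I ≤ colRank A G :=
        Submodule.finrank_mono (span_mono (Set.image_mono (by exact_mod_cast hIG)))
      omega
  · intro hG
    refine ⟨isFlat_of_uniform hn hA (by omega), ?_⟩
    rw [colRank_eq_card_of_uniform hn hA (by omega)]
    omega

/-- A rank `d` matrix is uniform once all `d`-sets of columns containing any given one are bases. -/
theorem linearIndependent_of_choose_le (hd : 1 ≤ d) (hrank : colRank A univ = d)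
    (h : ∀ e : Fin n, (n - 1).choose (d - 1) ≤ #{S ∈ flatBases A univ | e ∈ S})
    (I : Finset (Fin n)) (hI : #I = d) : LinearIndependent ℝ (fun i : ↥I => matCol A i) := by
  obtain ⟨e, he⟩ : I.Nonempty := card_pos.1 (by omega)
  have hsub : {S ∈ flatBases A univ | e ∈ S} ⊆
      {S ∈ powersetCard d (univ : Finset (Fin n)) | e ∈ S} := by
    refine filter_subset_filter _ ?_
    rw [flatBases, hrank]
    exact filter_subset _ _
  have heq := eq_of_subset_of_card_le hsub (by rw [card_powersetCard_filter_mem hd]; exact h e)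
  have hmem : I ∈ {S ∈ flatBases A univ | e ∈ S} := by
    rw [heq]
    simp [hI, he]
  have hcl : flatClosure A I = univ := (mem_filter.1 (mem_filter.1 hmem).1).2
  rw [linearIndependent_iff_colRank_eq_card, ← colRank_flatClosure, hcl, hrank, hI]

end Uniform

/-- The numerical core: `w` is the top and `W` the second Whitney number. -/
theorem whitney_bound {d n : ℕ} (hd : 2 ≤ d) (hn : d ≤ n) {w W : ℤ}
    (h1 : (n : ℤ) * w ≤ (n - d + 1) * W) (h2 : w ≤ (n - 1).choose (d - 1)) :
    d * w - W ≤ ((n - d : ℕ) : ℤ) * (n - 1).choose (d - 2) ∧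
      (d * w - W = ((n - d : ℕ) : ℤ) * (n - 1).choose (d - 2) → d < n →
        w = (n - 1).choose (d - 1)) := by
  obtain ⟨k, rfl⟩ := Nat.exists_eq_add_of_le hd
  obtain ⟨m, rfl⟩ := Nat.exists_eq_add_of_le hn
  have e1 : 2 + k + m - 1 = k + m + 1 := by omega
  have e2 : 2 + k - 1 = k + 1 := by omega
  have hc := Nat.choose_succ_right_eq (k + m + 1) k
  have e3 : k + m + 1 - k = m + 1 := by omega
  simp only [e1, e2, Nat.add_sub_cancel_left] at h2 ⊢
  rw [e3] at hc
  have hc' : ((k + m + 1).choose (k + 1) : ℤ) * (k + 1) = (k + m + 1).choose k * (m + 1) := by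
    exact_mod_cast hc
  generalize ((k + m + 1).choose (k + 1) : ℤ) = a at *
  generalize ((k + m + 1).choose k : ℤ) = b at *
  push_cast at h1 ⊢
  have key : (m + 1 : ℤ) * ((2 + k) * w - W) ≤ (m + 1) * (m * b) - m * (k + 1) * (a - w) := by
    linear_combination h1 + (m : ℤ) * hc'
  have hp : (0 : ℤ) < m + 1 := by positivity
  refine ⟨?_, fun heq hm => ?_⟩
  · refine le_of_mul_le_mul_left (key.trans ?_) hp
    have : (0 : ℤ) ≤ m * (k + 1) * (a - w) := mul_nonneg (by positivity) (by linarith)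
    linarith
  · rw [heq] at key
    have hm' : (0 : ℤ) < m * (k + 1) := by
      have : 0 < m := by omega
      positivity
    have : a - w ≤ 0 := nonpos_of_mul_nonpos_right (by linarith) hm'
    linarith

theorem whitney_eq_of_uniform {d n : ℕ} (hd : 2 ≤ d) (hn : d ≤ n) {w W : ℤ}
    (h1 : (n : ℤ) * w = (n - d + 1) * W) (h2 : W = n.choose (d - 1)) :
    d * w - W = ((n - d : ℕ) : ℤ) * (n - 1).choose (d - 2) := by
  obtain ⟨k, rfl⟩ := Nat.exists_eq_add_of_le hd
  obtain ⟨m, rfl⟩ := Nat.exists_eq_add_of_le hn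
  have e1 : 2 + k + m - 1 = k + m + 1 := by omega
  have e2 : 2 + k - 1 = k + 1 := by omega
  have e3 : 2 + k + m = k + m + 1 + 1 := by omega
  have hc := Nat.add_one_mul_choose_eq (k + m + 1) k
  rw [e2, e3] at h2
  simp only [e1, Nat.add_sub_cancel_left]
  have hc' : ((k : ℤ) + m + 1 + 1) * (k + m + 1).choose k = W * (k + 1) := by
    rw [h2]
    exact_mod_cast hc
  generalize ((k + m + 1).choose k : ℤ) = b at *
  push_cast at h1 ⊢
  have hp : (k : ℤ) + m + 1 + 1 ≠ 0 := by positivity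
  apply mul_left_cancel₀ hp
  linear_combination (2 + k : ℤ) * h1 - (m : ℤ) * hc'

/-- The degree `2(−1)^d (d·χ(0) + χ′(0)) = 2(−1)^d (d·μ(∅,[n]) + Σ_{rk F = d−1} μ(∅,F))`
of the entropic discriminant is at most `2(n−d)·C(n−1,d−2)`, with equality iff every `d`
columns of `A` are linearly independent (the matroid of `A` is uniform). -/
theorem stmt_9 {d n : ℕ} (hd : 2 ≤ d) (A : Matrix (Fin d) (Fin n) ℝ)
    (hrank : A.rank = d) (hcol : ∀ j, matCol A j ≠ 0)
    (μ : Finset (Fin n) → Finset (Fin n) → ℤ)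
    (hrefl : ∀ F, IsFlat A F → μ F F = 1)
    (hsum : ∀ F H, IsFlat A F → IsFlat A H → F ⊂ H →
      ∑ G ∈ H.powerset.filter (fun G => IsFlat A G ∧ F ⊆ G), μ F G = 0) :
    2 * (-1 : ℤ) ^ d * ((d : ℤ) * μ ∅ Finset.univ +
        ∑ F ∈ Finset.univ.filter (fun F : Finset (Fin n) => IsFlat A F ∧
          Module.finrank ℝ (Submodule.span ℝ (matCol A '' ↑F)) = d - 1), μ ∅ F) ≤
      2 * ((n - d : ℕ) : ℤ) * ((n - 1).choose (d - 2) : ℤ) ∧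
    (2 * (-1 : ℤ) ^ d * ((d : ℤ) * μ ∅ Finset.univ +
        ∑ F ∈ Finset.univ.filter (fun F : Finset (Fin n) => IsFlat A F ∧
          Module.finrank ℝ (Submodule.span ℝ (matCol A '' ↑F)) = d - 1), μ ∅ F) =
      2 * ((n - d : ℕ) : ℤ) * ((n - 1).choose (d - 2) : ℤ) ↔
      ∀ I : Finset (Fin n), I.card = d →
        LinearIndependent ℝ (fun i : ↥I => matCol A i)) := by
  have hr : colRank A univ = d := colRank_univ.trans hrank
  have hn : d ≤ n := by
    simpa [hr] using colRank_le_card (A := A) (S := univ)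
  have hempty := isFlat_empty hcol
  have h0 : μ ∅ ∅ = 1 := hrefl ∅ hempty
  have hf : ∀ F, IsFlat A F → F.Nonempty → ∑ G with IsFlat A G ∧ G ⊆ F, μ ∅ G = 0 := by
    intro F hF hne
    rw [← hsum ∅ F hempty hF (empty_ssubset.2 hne)]
    refine sum_congr ?_ fun _ _ => rfl
    ext G
    simp [and_comm]
  have hfilter : univ.filter (fun F : Finset (Fin n) => IsFlat A F ∧
      Module.finrank ℝ (span ℝ (matCol A '' ↑F)) = d - 1) =
      univ.filter (fun F => IsFlat A F ∧ colRank A F + 1 = d) := by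
    ext F
    simp only [mem_filter, mem_univ, true_and]
    rw [colRank]
    refine and_congr_right fun _ => ?_
    omega
  rw [hfilter]
  set w : ℤ := (-1) ^ d * μ ∅ univ with hw
  set W : ℤ := ∑ F with IsFlat A F ∧ colRank A F + 1 = d, (-1) ^ colRank A F * μ ∅ F with hW
  have hLHS : 2 * (-1 : ℤ) ^ d * ((d : ℤ) * μ ∅ univ +
      ∑ F with IsFlat A F ∧ colRank A F + 1 = d, μ ∅ F) = 2 * (d * w - W) := by
    have : W = -(-1) ^ d * ∑ F with IsFlat A F ∧ colRank A F + 1 = d, μ ∅ F := by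
      rw [hW, mul_sum]
      refine sum_congr rfl fun F hF => ?_
      have hpow : (-1 : ℤ) ^ d = (-1) ^ (colRank A F + 1) := by rw [(mem_filter.1 hF).2.2]
      rw [hpow, pow_succ]
      ring
    rw [this, hw]
    ring
  have hweis := card_mul_neg_one_pow_mul_univ hf
  rw [hr, ← hw] at hweis
  have h1 : (n : ℤ) * w ≤ (n - d + 1) * W := by
    rw [hweis, hW, mul_sum]
    refine sum_le_sum fun F hF => ?_
    obtain ⟨hF, hrF⟩ := (mem_filter.1 hF).2
    refine mul_le_mul_of_nonneg_right ?_ (neg_one_pow_mul_nonneg h0 hf F hF)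
    have : colRank A F ≤ #F := colRank_le_card
    omega
  have hbases : ∀ e : Fin n, w ≤ #{S ∈ flatBases A univ | e ∈ S} := fun e => by
    have := neg_one_pow_mul_le_card_flatBases_filter_mem h0 hf isFlat_univ (mem_univ e)
    rwa [hr] at this
  have h2 : w ≤ (n - 1).choose (d - 1) := by
    have e : Fin n := ⟨0, by omega⟩
    rw [← card_powersetCard_filter_mem (by omega) e]
    refine (hbases e).trans (Nat.cast_le.2 (card_le_card (filter_subset_filter _ ?_)))
    rw [flatBases, hr]
    exact filter_subset _ _
  obtain ⟨hle, heq⟩ := whitney_bound hd hn h1 h2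
  rw [hLHS, mul_assoc 2 ((n - d : ℕ) : ℤ)]
  refine ⟨by linarith, fun h => ?_, fun hA => ?_⟩
  · obtain rfl | hlt := hn.eq_or_lt
    · intro I hI
      obtain rfl : I = univ := (card_eq_iff_eq_univ I).1 (by simpa using hI)
      rw [linearIndependent_iff_colRank_eq_card, hr, hI]
    · refine linearIndependent_of_choose_le (by omega) hr fun e => ?_
      have := hbases e
      rw [heq (by linarith) hlt] at this
      exact_mod_cast this
  · rw [whitney_eq_of_uniform hd hn (w := w) (W := W)]
    · rw [hweis, hW, mul_sum, filter_isFlat_of_uniform (by omega) hn hA]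
      refine sum_congr rfl fun F hF => ?_
      have hc : #F = d - 1 := (mem_powersetCard.1 hF).2
      rw [hc]
      push_cast [show 1 ≤ d by omega]
      ring
    · rw [hW, filter_isFlat_of_uniform (by omega) hn hA, sum_congr rfl (g := fun _ => (1 : ℤ))]
      · simp
      · intro F hF
        have hc : #F = d - 1 := (mem_powersetCard.1 hF).2
        rw [eq_neg_one_pow_card_of_uniform hn h0 hf hA F (by omega),
          colRank_eq_card_of_uniform hn hA (by omega), ← mul_pow]
        simp
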